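/- arXiv:2009.08191 — 2 statements merged into one kernel-verified Lean document; each statement's English description precedes it below -/
import Mathlib

section
/- Let τ be a permutation of the vectors of F^r fixing 0 that is not a linear map (equivalently, the Steiner quadruple system SQS_τ is non-affine). Then for any pair of distinct vectors a, b ∈ F^r, the symmetric difference (taken separately on the left and right halves of the point set) of any two distinct quadruples from Q_0(a,b) is again a quadruple of SQS_τ, and the same holds for any two distinct quadruples from Q_1(a,b). -/
open Finset

/-- `V r` is the vector space `F^r` over `F = GF(2)`. -/
abbrev V (r : ℕ) : Type := Fin r → ZMod 2

/-- The point set of `SQS_τ` (and the coordinate set of codes of length `2^{r+1}`):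
left-half points `({a},∅)` are `Sum.inl a`, right-half points `(∅,{a})` are `Sum.inr a`. -/
abbrev Pt (r : ℕ) : Type := V r ⊕ V r

/-- Action of a coordinate permutation `π` on a word: `π(y)_i = y_{π⁻¹(i)}`. -/
def permAct {ι : Type} (π : Equiv.Perm ι) (y : ι → ZMod 2) : ι → ZMod 2 :=
  fun i => y (π.symm i)

/-- The extended Hamming code of length `2^r`, with coordinates indexed by the vectors
of `F^r`: all even weight words whose support sums to zero. -/
def extHamming (r : ℕ) : Set (V r → ZMod 2) :=
  {x | ∑ a : V r, x a • a = 0 ∧ ∑ a : V r, x a = 0}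

/-- `e_a` : the weight-one word with support `{a}`. -/
def unitVec {r : ℕ} (a : V r) : V r → ZMod 2 :=
  fun b => if b = a then 1 else 0

/-- The code `S_τ = ⋃_{a ∈ F^r} (H + e_a + e_0) × (H + e_{τ(a)} + e_0)` of length `2^{r+1}`. -/
def Scode {r : ℕ} (τ : Equiv.Perm (V r)) : Set (Pt r → ZMod 2) :=
  ⋃ a : V r, {z | ∃ h₁ ∈ extHamming r, ∃ h₂ ∈ extHamming r,
    z = Sum.elim (h₁ + unitVec a + unitVec 0) (h₂ + unitVec (τ a) + unitVec 0)}

/-- `Q_0` : quadruples `({a,b,c,d},∅)`, `a,b,c,d` pairwise distinct, `a+b+c+d=0`. -/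
def Q0 (r : ℕ) : Set (Finset (Pt r)) :=
  {q | ∃ a b c d : V r, a ≠ b ∧ a ≠ c ∧ a ≠ d ∧ b ≠ c ∧ b ≠ d ∧ c ≠ d ∧
    a + b + c + d = 0 ∧ q = {Sum.inl a, Sum.inl b, Sum.inl c, Sum.inl d}}

/-- `Q_1` : quadruples `(∅,{a,b,c,d})`, `a,b,c,d` pairwise distinct, `a+b+c+d=0`. -/
def Q1 (r : ℕ) : Set (Finset (Pt r)) :=
  {q | ∃ a b c d : V r, a ≠ b ∧ a ≠ c ∧ a ≠ d ∧ b ≠ c ∧ b ≠ d ∧ c ≠ d ∧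
    a + b + c + d = 0 ∧ q = {Sum.inr a, Sum.inr b, Sum.inr c, Sum.inr d}}

/-- `Q_τ` : quadruples `({a,c},{b,d})` with `τ(a+c) = b+d ≠ 0`. -/
def Qt {r : ℕ} (τ : Equiv.Perm (V r)) : Set (Finset (Pt r)) :=
  {q | ∃ a b c d : V r, τ (a + c) = b + d ∧ b + d ≠ 0 ∧
    q = {Sum.inl a, Sum.inl c, Sum.inr b, Sum.inr d}}

/-- The Steiner quadruple system `SQS_τ = Q_0 ∪ Q_1 ∪ Q_τ`. -/
def SQS {r : ℕ} (τ : Equiv.Perm (V r)) : Set (Finset (Pt r)) :=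
  Q0 r ∪ Q1 r ∪ Qt τ

/-- Action of a point bijection on a set system. -/
def qAct {α β : Type} [DecidableEq β] (π : α ≃ β) (Q : Set (Finset α)) : Set (Finset β) :=
  (fun q => q.image π) '' Q

/-- All quadruples of the system `Q` containing both points `p` and `p'`. -/
def quadsThrough {r : ℕ} (Q : Set (Finset (Pt r))) (p p' : Pt r) : Set (Finset (Pt r)) :=
  {q ∈ Q | p ∈ q ∧ p' ∈ q}

/-- The affine permutation `σ_{a,A} : b ↦ a + A b` of `F^r`, where `A ∈ GL(r,2)`. -/
def affEquiv {r : ℕ} (a : V r) (A : V r ≃ₗ[ZMod 2] V r) : Equiv.Perm (V r) :=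
  A.toEquiv.trans (Equiv.addLeft a)

/-- The permutation `ξ` swapping `({a},∅)` with `(∅,{a})` for every `a`. -/
def xi (r : ℕ) : Equiv.Perm (Pt r) := Equiv.sumComm (V r) (V r)

/-- Point transitivity of the Steiner quadruple system `SQS_τ`. -/
def SQSPointTransitive {r : ℕ} (τ : Equiv.Perm (V r)) : Prop :=
  ∀ p p' : Pt r, ∃ π : Equiv.Perm (Pt r), qAct π (SQS τ) = SQS τ ∧ π p = p'

/-- A code is transitive if (a subgroup of) its automorphism group acts transitively
on its codewords: any codeword is mapped to any other by an automorphism `y ↦ x + π(y)`. -/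
def IsTransitiveCode {ι : Type} (C : Set (ι → ZMod 2)) : Prop :=
  ∀ c ∈ C, ∀ c' ∈ C, ∃ (x : ι → ZMod 2) (π : Equiv.Perm ι),
    (fun y => x + permAct π y) '' C = C ∧ x + permAct π c = c'

/-- A code is coordinate transitive if `PAut(C)` acts transitively on coordinates. -/
def CoordTransitive {ι : Type} (C : Set (ι → ZMod 2)) : Prop :=
  ∀ i j : ι, ∃ π : Equiv.Perm ι, permAct π '' C = C ∧ π i = j

/-- `C_1` : the words at Hamming distance exactly 1 from the code `C`. -/
def codeNbrs {ι : Type} [Fintype ι] (C : Set (ι → ZMod 2)) : Set (ι → ZMod 2) :=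
  {y | y ∉ C ∧ ∃ c ∈ C, hammingDist y c = 1}

/-- A code is neighbor transitive if `Aut(C)` acts transitively both on `C` and on `C_1`. -/
def NeighborTransitive {ι : Type} [Fintype ι] (C : Set (ι → ZMod 2)) : Prop :=
  IsTransitiveCode C ∧
  ∀ y ∈ codeNbrs C, ∀ y' ∈ codeNbrs C, ∃ (x : ι → ZMod 2) (π : Equiv.Perm ι),
    (fun w => x + permAct π w) '' C = C ∧ x + permAct π y = y'

/-- An extended perfect code: minimum distance 4 and `2^n/(2n)` codewords. -/
def IsExtPerfect {ι : Type} [Fintype ι] (C : Set (ι → ZMod 2)) : Prop :=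
  (∀ x ∈ C, ∀ y ∈ C, x ≠ y → 4 ≤ hammingDist x y) ∧
  (∃ x ∈ C, ∃ y ∈ C, hammingDist x y = 4) ∧
  Nat.card C * (2 * Fintype.card ι) = 2 ^ Fintype.card ι

/-- The (extended) Mollard code `M(C,D)` with function `φ`. -/
def mollard {t m : ℕ} (C : Set (Fin t → ZMod 2)) (D : Set (Fin m → ZMod 2))
    (φ : (Fin t → ZMod 2) → (Fin m → ZMod 2)) : Set (Fin t × Fin m → ZMod 2) :=
  {z | (fun i => ∑ j, z (i, j)) ∈ C ∧
       ∃ d ∈ D, (fun j => ∑ i, z (i, j)) = φ (fun i => ∑ j, z (i, j)) + d}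

/-- Isomorphism of codes over possibly different coordinate sets:
`D = x + π(C)` for a coordinate bijection `π` and a vector `x`. -/
def CodeIso {ι κ : Type} (C : Set (ι → ZMod 2)) (D : Set (κ → ZMod 2)) : Prop :=
  ∃ (e : ι ≃ κ) (x : κ → ZMod 2), (fun z => x + fun k => z (e.symm k)) '' C = D

/-- The rank of a code: the dimension of its linear span. -/
noncomputable def codeRank {ι : Type} (C : Set (ι → ZMod 2)) : ℕ :=
  Module.finrank (ZMod 2) ↥(Submodule.span (ZMod 2) C)

/-- The kernel of a code: `{x : x + C = C}`. -/
def codeKernel {ι : Type} (C : Set (ι → ZMod 2)) : Set (ι → ZMod 2) :=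
  {x | (fun y => x + y) '' C = C}

/-- The dimension of the kernel of a code. -/
noncomputable def kernelDim {ι : Type} (C : Set (ι → ZMod 2)) : ℕ :=
  codeRank (codeKernel C)

/-- A permutation of `F^r` is affine if it is of the form `b ↦ a + A b`, `A ∈ GL(r,2)`. -/
def IsAffinePerm {r : ℕ} (g : Equiv.Perm (V r)) : Prop :=
  ∃ (a : V r) (A : V r ≃ₗ[ZMod 2] V r), ∀ x, g x = a + A x

/-- A regular subgroup of `GA(r,2)`: a subgroup consisting of affine permutations that
acts sharply transitively on `F^r`. -/
def IsRegularAffineSubgroup {r : ℕ} (G : Subgroup (Equiv.Perm (V r))) : Prop :=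
  (∀ g ∈ G, IsAffinePerm g) ∧ ∀ u v : V r, ∃! g : G, (g : Equiv.Perm (V r)) u = v

/-- `τ` is induced by an automorphism `T` of a regular subgroup `G ≤ GA(r,2)`:
`T(g_a) = g_{τ(a)}`, i.e. `τ(g(0)) = (T g)(0)` for every `g ∈ G`. -/
def InducedByRegularAut {r : ℕ} (τ : Equiv.Perm (V r)) : Prop :=
  ∃ G : Subgroup (Equiv.Perm (V r)), IsRegularAffineSubgroup G ∧
    ∃ T : G ≃* G, ∀ g : G, τ ((g : Equiv.Perm (V r)) 0) = (T g : Equiv.Perm (V r)) 0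

/-- The identification `F^{r+r'} ≃ F^r × F^{r'}`, `x|y ↦ (x,y)`. -/
def splitEquiv (r r' : ℕ) : V (r + r') ≃ V r × V r' :=
  (finSumFinEquiv.symm.arrowCongr (Equiv.refl (ZMod 2))).trans
    (Equiv.sumArrowEquivProdArrow _ _ _)

/-- The concatenation `τ|τ'` of permutations: `(τ|τ')(x|y) = τ(x)|τ'(y)`. -/
def concatPerm {r r' : ℕ} (τ : Equiv.Perm (V r)) (τ' : Equiv.Perm (V r')) :
    Equiv.Perm (V (r + r')) :=
  (splitEquiv r r').trans ((τ.prodCongr τ').trans (splitEquiv r r').symm)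

theorem symmDiff_pairs {α : Type} [DecidableEq α] {u v p x p' y : α}
    (b1 : p ≠ u) (b2 : p ≠ v) (b3 : p' ≠ u) (b4 : p' ≠ v)
    (a1 : x ≠ u) (a2 : x ≠ v) (a3 : y ≠ u) (a4 : y ≠ v)
    (h1 : p ≠ p') (h2 : p' ≠ x) (a5 : p ≠ y) (a6 : x ≠ y) :
    symmDiff ({u, v, p, x} : Finset α) {u, v, p', y} = {p, x, p', y} := by
  ext z
  simp only [Finset.mem_symmDiff, Finset.mem_insert, Finset.mem_singleton]
  constructor
  · rintro (⟨h, h'⟩ | ⟨h, h'⟩) <;> tauto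
  · rintro (rfl | rfl | rfl | rfl)
    · left; simp [b1, b2, h1, a5]
    · left; simp [a1, a2, h2.symm, a6]
    · right; simp [b3, b4, h1.symm, h2]
    · right; simp [a3, a4, a5.symm, a6.symm]

theorem quad_swap {α : Type} [DecidableEq α] (x z y w : α) :
    ({x, z, y, w} : Finset α) = {y, w, x, z} := by
  ext t
  simp only [Finset.mem_insert, Finset.mem_singleton]
  tauto

/-- The translation of both halves by `s` and `t`. -/
def gmap {r : ℕ} (s t : V r) : Pt r → Pt r :=
  Sum.map (fun x => x + s) (fun x => x + t)

theorem vadd_self {r : ℕ} (x : V r) : x + x = 0 := by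
  funext i
  exact CharTwo.add_self_eq_zero (x i)

theorem vadd_self_right {r : ℕ} (x y : V r) : x + y + y = x := by
  rw [add_assoc, vadd_self, add_zero]

theorem vadd_ne {r : ℕ} {x s : V r} (hs : s ≠ 0) : x + s ≠ x := by
  simpa using hs

theorem vsum_zero {r : ℕ} {a b c d : V r} (h : a + b + c + d = 0) : d = c + (a + b) := by
  have := vadd_self_right (a + b + c) d
  rw [h, zero_add] at this
  rw [this]; abel

theorem gmap_invol {r : ℕ} (s t : V r) (p : Pt r) : gmap s t (gmap s t p) = p := by
  rcases p with x | x <;> simp [gmap, vadd_self_right]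

theorem gmap_ne {r : ℕ} {s t : V r} (hs : s ≠ 0) (ht : t ≠ 0) (p : Pt r) :
    gmap s t p ≠ p := by
  rcases p with x | x <;> simp [gmap, hs, ht]

theorem pairs_mem {r : ℕ} (τ : Equiv.Perm (V r)) {s t : V r} (hs : s ≠ 0) (ht : t ≠ 0)
    (hst : τ s = t) (p q : Pt r) (h1 : p ≠ q) (h2 : q ≠ gmap s t p) :
    ({p, gmap s t p, q, gmap s t q} : Finset (Pt r)) ∈ SQS τ := by
  have key : ∀ x y u : V r, x + (x + u) + y + (y + u) = 0 := by
    intro x y u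
    have : x + (x + u) + y + (y + u) = (x + x) + (y + y) + (u + u) := by abel
    rw [this]; simp [vadd_self]
  have key2 : ∀ x u : V r, x + (x + u) = u := by
    intro x u
    rw [← add_assoc, vadd_self, zero_add]
  rcases p with x | x <;> rcases q with y | y
  · left; left
    have h1' : x ≠ y := fun h => h1 (by rw [h])
    have h2' : y ≠ x + s := fun h => h2 (by rw [h]; rfl)
    refine ⟨x, x + s, y, y + s, (vadd_ne hs).symm, h1', ?_, h2'.symm, ?_, (vadd_ne hs).symm,
      key _ _ _, rfl⟩
    · intro h; apply h2'; rw [h, vadd_self_right]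
    · intro h; exact h1' (add_right_cancel h)
  · right
    exact ⟨x, y, x + s, y + t, by rw [key2, key2, hst], by rw [key2]; exact ht, rfl⟩
  · right
    refine ⟨y, x, y + s, x + t, by rw [key2, key2, hst], by rw [key2]; exact ht, ?_⟩
    ext z; simp [gmap]; tauto
  · left; right
    have h1' : x ≠ y := fun h => h1 (by rw [h])
    have h2' : y ≠ x + t := fun h => h2 (by rw [h]; rfl)
    refine ⟨x, x + t, y, y + t, (vadd_ne ht).symm, h1', ?_, h2'.symm, ?_, (vadd_ne ht).symm,
      key _ _ _, rfl⟩
    · intro h; apply h2'; rw [h, vadd_self_right]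
    · intro h; exact h1' (add_right_cancel h)

theorem quad_sum {r : ℕ} {a b x y z w : V r} (hab : a ≠ b)
    (h12 : x ≠ y) (h13 : x ≠ z) (h14 : x ≠ w) (h23 : y ≠ z) (h24 : y ≠ w) (h34 : z ≠ w)
    (hsum : x + y + z + w = 0)
    (ha : a = x ∨ a = y ∨ a = z ∨ a = w) (hb : b = x ∨ b = y ∨ b = z ∨ b = w) :
    ∃ c, c ≠ a ∧ c ≠ b ∧ ({x, y, z, w} : Finset (V r)) = {a, b, c, c + (a + b)} := by
  have main : ∀ c d : V r, c ≠ a → c ≠ b → a + b + c + d = 0 →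
      ({x, y, z, w} : Finset (V r)) = {a, b, c, d} →
      ∃ c, c ≠ a ∧ c ≠ b ∧ ({x, y, z, w} : Finset (V r)) = {a, b, c, c + (a + b)} := by
    intro c d h1 h2 h3 h4
    exact ⟨c, h1, h2, by rw [h4, vsum_zero h3]⟩
  rcases ha with rfl | rfl | rfl | rfl <;> rcases hb with rfl | rfl | rfl | rfl
  · exact absurd rfl hab
  · exact main z w h13.symm h23.symm hsum rfl
  · exact main y w h12.symm h23 (by rw [← hsum]; abel) (by grind)
  · exact main y z h12.symm h24 (by rw [← hsum]; abel) (by grind)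
  · exact main z w h23.symm h13.symm (by rw [← hsum]; abel) (by grind)
  · exact absurd rfl hab
  · exact main x w h12 h13 (by rw [← hsum]; abel) (by grind)
  · exact main x z h12 h14 (by rw [← hsum]; abel) (by grind)
  · exact main y w h23 h12.symm (by rw [← hsum]; abel) (by grind)
  · exact main x w h13 h12 (by rw [← hsum]; abel) (by grind)
  · exact absurd rfl hab
  · exact main x y h13 h14 (by rw [← hsum]; abel) (by grind)
  · exact main y z h24 h12.symm (by rw [← hsum]; abel) (by grind)
  · exact main x z h14 h12 (by rw [← hsum]; abel) (by grind)
  · exact main x y h14 h13 (by rw [← hsum]; abel) (by grind)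
  · exact absurd rfl hab

theorem symm_gen {r : ℕ} (τ : Equiv.Perm (V r)) {s t : V r} (hs : s ≠ 0) (ht : t ≠ 0)
    (hst : τ s = t) (u v : Pt r) (huv : v = gmap s t u) (q q' : Finset (Pt r))
    (hq : ∃ p, p ≠ u ∧ p ≠ v ∧ q = {u, v, p, gmap s t p})
    (hq' : ∃ p, p ≠ u ∧ p ≠ v ∧ q' = {u, v, p, gmap s t p}) (hne : q ≠ q') :
    symmDiff q q' ∈ SQS τ := by
  obtain ⟨p, hpu, hpv, rfl⟩ := hq
  obtain ⟨p', hpu', hpv', rfl⟩ := hq'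
  have inv := gmap_invol s t
  have nf := gmap_ne hs ht
  have h1 : p ≠ p' := by rintro rfl; exact hne rfl
  have h2 : p' ≠ gmap s t p := by
    rintro rfl; apply hne; rw [inv]; ext z; simp; tauto
  have e : symmDiff ({u, v, p, gmap s t p} : Finset (Pt r)) {u, v, p', gmap s t p'}
      = {p, gmap s t p, p', gmap s t p'} := by
    generalize gmap s t = g at *
    have i1 := inv p
    have i2 := inv p'
    have i3 := inv u
    have a1 : g p ≠ u := by grind
    have a2 : g p ≠ v := by grind
    have a3 : g p' ≠ u := by grind
    have a4 : g p' ≠ v := by grind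
    have a5 : p ≠ g p' := by grind
    have a6 : g p ≠ g p' := by grind
    exact symmDiff_pairs hpu hpv hpu' hpv' a1 a2 a3 a4 h1 h2 a5 a6
  rw [e]
  exact pairs_mem τ hs ht hst p p' h1 h2

theorem vdiff {r : ℕ} {x y u : V r} (h : x + y = u) : y = x + u := by
  rw [← h, ← add_assoc, vadd_self, zero_add]

theorem nf_left {r : ℕ} (τ : Equiv.Perm (V r)) {a b : V r} (hab : a ≠ b)
    (q : Finset (Pt r)) (hq : q ∈ quadsThrough (SQS τ) (Sum.inl a) (Sum.inl b)) :
    ∃ p, p ≠ Sum.inl a ∧ p ≠ Sum.inl b ∧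
      q = {Sum.inl a, Sum.inl b, p, gmap (a + b) (τ (a + b)) p} := by
  obtain ⟨hq, ha, hb⟩ := hq
  rcases hq with (⟨x, y, z, w, h12, h13, h14, h23, h24, h34, hsum, rfl⟩ |
    ⟨x, y, z, w, h12, h13, h14, h23, h24, h34, hsum, rfl⟩) | ⟨x, y, z, w, h1, h2, rfl⟩
  · obtain ⟨c, c1, c2, e⟩ := quad_sum hab h12 h13 h14 h23 h24 h34 hsum
      (by simpa using ha) (by simpa using hb)
    refine ⟨Sum.inl c, by simpa using c1, by simpa using c2, ?_⟩
    have := congrArg (Finset.image (Sum.inl : V r → Pt r)) e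
    simpa [Finset.image_insert, gmap] using this
  · simp at ha
  · have ha' : a = x ∨ a = z := by simpa using ha
    have hb' : b = x ∨ b = z := by simpa using hb
    refine ⟨Sum.inr y, by simp, by simp, ?_⟩
    have e : x + z = a + b := by
      rcases ha' with rfl | rfl <;> rcases hb' with rfl | rfl
      · exact absurd rfl hab
      · rfl
      · rw [add_comm]
      · exact absurd rfl hab
    rw [e] at h1
    have hw := vdiff h1.symm
    simp only [gmap, Sum.map_inr, ← hw]
    rcases ha' with rfl | rfl <;> rcases hb' with rfl | rfl
    · exact absurd rfl hab
    · rfl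
    · exact Finset.insert_comm _ _ _
    · exact absurd rfl hab

theorem nf_right {r : ℕ} (τ : Equiv.Perm (V r)) {a b : V r} (hab : a ≠ b)
    (q : Finset (Pt r)) (hq : q ∈ quadsThrough (SQS τ) (Sum.inr a) (Sum.inr b)) :
    ∃ p, p ≠ Sum.inr a ∧ p ≠ Sum.inr b ∧
      q = {Sum.inr a, Sum.inr b, p, gmap (τ.symm (a + b)) (a + b) p} := by
  obtain ⟨hq, ha, hb⟩ := hq
  rcases hq with (⟨x, y, z, w, h12, h13, h14, h23, h24, h34, hsum, rfl⟩ |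
    ⟨x, y, z, w, h12, h13, h14, h23, h24, h34, hsum, rfl⟩) | ⟨x, y, z, w, h1, h2, rfl⟩
  · simp at ha
  · obtain ⟨c, c1, c2, e⟩ := quad_sum hab h12 h13 h14 h23 h24 h34 hsum
      (by simpa using ha) (by simpa using hb)
    refine ⟨Sum.inr c, by simpa using c1, by simpa using c2, ?_⟩
    have := congrArg (Finset.image (Sum.inr : V r → Pt r)) e
    simpa [Finset.image_insert, gmap] using this
  · have ha' : a = y ∨ a = w := by simpa using ha
    have hb' : b = y ∨ b = w := by simpa using hb
    refine ⟨Sum.inl x, by simp, by simp, ?_⟩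
    have e : y + w = a + b := by
      rcases ha' with rfl | rfl <;> rcases hb' with rfl | rfl
      · exact absurd rfl hab
      · rfl
      · rw [add_comm]
      · exact absurd rfl hab
    rw [e] at h1
    have hw : z = x + τ.symm (a + b) := vdiff (by rw [← h1]; simp)
    simp only [gmap, Sum.map_inl, ← hw]
    rcases ha' with rfl | rfl <;> rcases hb' with rfl | rfl
    · exact absurd rfl hab
    · exact quad_swap _ _ _ _
    · rw [quad_swap]; exact Finset.insert_comm _ _ _
    · exact absurd rfl hab

/-- if `τ` is not linear (so `SQS_τ` is non-affine), then for distinct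
`a, b ∈ F^r` the symmetric difference of any two distinct quadruples of `Q_0(a,b)`
(resp. `Q_1(a,b)`) is again a quadruple of `SQS_τ`. -/
theorem symmDiff_mem_of_Q0ab_Q1ab {r : ℕ} (τ : Equiv.Perm (V r)) (h0 : τ 0 = 0)
    (hnl : ¬ ∀ x y : V r, τ (x + y) = τ x + τ y) :
    ∀ a b : V r, a ≠ b →
      (∀ q ∈ quadsThrough (SQS τ) (Sum.inl a) (Sum.inl b),
        ∀ q' ∈ quadsThrough (SQS τ) (Sum.inl a) (Sum.inl b),
          q ≠ q' → symmDiff q q' ∈ SQS τ) ∧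
      (∀ q ∈ quadsThrough (SQS τ) (Sum.inr a) (Sum.inr b),
        ∀ q' ∈ quadsThrough (SQS τ) (Sum.inr a) (Sum.inr b),
          q ≠ q' → symmDiff q q' ∈ SQS τ) := by
  intro a b hab
  have hs : a + b ≠ 0 := by
    intro h
    apply hab
    have := vdiff h
    rw [this, add_zero]
  have hu : b = a + (a + b) := vdiff rfl
  constructor
  · intro q hq q' hq' hne
    have ht : τ (a + b) ≠ 0 := fun h => hs (τ.injective (h.trans h0.symm))
    exact symm_gen τ hs ht rfl (Sum.inl a) (Sum.inl b) (congrArg Sum.inl hu) q q'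
      (nf_left τ hab q hq) (nf_left τ hab q' hq') hne
  · intro q hq q' hq' hne
    have ht : τ.symm (a + b) ≠ 0 := by
      intro h
      apply hs
      rw [← h0, ← h]; simp
    exact symm_gen τ ht hs (by simp) (Sum.inr a) (Sum.inr b) (congrArg Sum.inr hu) q q'
      (nf_right τ hab q hq) (nf_right τ hab q' hq') hne
end

section
/- Let τ be a permutation of the vectors of F^r with τ(0) = 0 and let ξ be the permutation of the points that swaps ({a},∅) with (∅,{a}) for every a ∈ F^r. Then ξ maps SQS_τ onto SQS_{τ^{-1}}; consequently, for any a, b ∈ F^r and A, B ∈ GL(r,2), the permutation (σ_{a,A} | σ_{b,B})·ξ maps SQS_τ onto SQS_{Bτ^{-1}A^{-1}}, where Bτ^{-1}A^{-1} denotes σ_B ∘ τ^{-1} ∘ σ_{A^{-1}}. -/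
open Finset

theorem qAct_trans_aux {α β γ : Type} [DecidableEq β] [DecidableEq γ] (π : α ≃ β) (ρ : β ≃ γ)
    (Q : Set (Finset α)) : qAct (π.trans ρ) Q = qAct ρ (qAct π Q) := by
  unfold qAct
  rw [Set.image_image]
  congr 1
  funext q
  rw [Finset.image_image]
  rfl

theorem qAct_eq_aux {α β : Type} [DecidableEq α] [DecidableEq β] (π : α ≃ β)
    (Q : Set (Finset α)) (R : Set (Finset β)) (h₁ : qAct π Q ⊆ R) (h₂ : qAct π.symm R ⊆ Q) :
    qAct π Q = R := by
  apply Set.Subset.antisymm h₁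
  intro q hq
  refine ⟨q.image π.symm, h₂ ⟨q, hq, rfl⟩, ?_⟩
  simp [Finset.image_image]

theorem xi_sub_aux {r : ℕ} (τ : Equiv.Perm (V r)) (h0 : τ 0 = 0) :
    qAct (xi r) (SQS τ) ⊆ SQS τ.symm := by
  rintro _ ⟨q, (⟨a, b, c, d, h1, h2, h3, h4, h5, h6, hs, rfl⟩ |
    ⟨a, b, c, d, h1, h2, h3, h4, h5, h6, hs, rfl⟩) | ⟨a, b, c, d, hs, hn, rfl⟩, rfl⟩
  · exact Or.inl (Or.inr ⟨a, b, c, d, h1, h2, h3, h4, h5, h6, hs,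
      by simp [xi, Finset.image_insert]⟩)
  · exact Or.inl (Or.inl ⟨a, b, c, d, h1, h2, h3, h4, h5, h6, hs,
      by simp [xi, Finset.image_insert]⟩)
  · refine Or.inr ⟨b, a, d, c, ?_, ?_, ?_⟩
    · rw [← hs, Equiv.symm_apply_apply]
    · intro h
      rw [h, h0] at hs
      exact hn hs.symm
    · ext x
      simp [xi, Finset.image_insert]
      tauto

theorem double_aux {r : ℕ} (a : V r) : a + a = 0 := by
  funext i
  exact CharTwo.add_self_eq_zero (a i)

theorem aff_add_aux {r : ℕ} (a : V r) (A : V r ≃ₗ[ZMod 2] V r) (x y : V r) :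
    affEquiv a A x + affEquiv a A y = A (x + y) := by
  have : affEquiv a A x + affEquiv a A y = (a + a) + (A x + A y) := by
    simp only [affEquiv, Equiv.trans_apply, Equiv.coe_addLeft, LinearEquiv.coe_toEquiv]
    abel
  rw [this, double_aux, zero_add, map_add]

theorem aff_sum_aux {r : ℕ} (a : V r) (A : V r ≃ₗ[ZMod 2] V r) (x y z w : V r)
    (h : x + y + z + w = 0) :
    affEquiv a A x + affEquiv a A y + affEquiv a A z + affEquiv a A w = 0 := by
  rw [add_assoc, aff_add_aux, aff_add_aux, ← map_add, ← add_assoc, h, map_zero]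

theorem aff_symm_aux {r : ℕ} (a : V r) (A : V r ≃ₗ[ZMod 2] V r) :
    (affEquiv a A).symm = affEquiv (A.symm a) A.symm := by
  ext1 x
  rw [Equiv.symm_apply_eq]
  simp [affEquiv, ← add_assoc, double_aux]

theorem aff_sub_aux {r : ℕ} (τ : Equiv.Perm (V r)) (a b : V r) (A B : V r ≃ₗ[ZMod 2] V r) :
    qAct (Equiv.sumCongr (affEquiv a A) (affEquiv b B)) (SQS τ) ⊆
      SQS (A.symm.toEquiv.trans (τ.trans B.toEquiv)) := by
  have iA := (affEquiv a A).injective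
  have iB := (affEquiv b B).injective
  rintro _ ⟨q, (⟨x, y, z, w, h1, h2, h3, h4, h5, h6, hs, rfl⟩ |
    ⟨x, y, z, w, h1, h2, h3, h4, h5, h6, hs, rfl⟩) | ⟨x, y, z, w, hs, hn, rfl⟩, rfl⟩
  · exact Or.inl (Or.inl ⟨_, _, _, _, iA.ne h1, iA.ne h2, iA.ne h3, iA.ne h4, iA.ne h5, iA.ne h6,
      aff_sum_aux a A x y z w hs, by simp [Finset.image_insert]⟩)
  · exact Or.inl (Or.inr ⟨_, _, _, _, iB.ne h1, iB.ne h2, iB.ne h3, iB.ne h4, iB.ne h5, iB.ne h6,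
      aff_sum_aux b B x y z w hs, by simp [Finset.image_insert]⟩)
  · refine Or.inr ⟨affEquiv a A x, affEquiv b B y, affEquiv a A z, affEquiv b B w, ?_, ?_, ?_⟩
    · rw [aff_add_aux, aff_add_aux, ← hs]
      simp only [Equiv.trans_apply, LinearEquiv.coe_toEquiv, LinearEquiv.symm_apply_apply]
    · rw [aff_add_aux]
      exact fun h => hn (B.map_eq_zero_iff.mp h)
    · simp [Finset.image_insert]

theorem xi_eq_aux {r : ℕ} (τ : Equiv.Perm (V r)) (h0 : τ 0 = 0) :
    qAct (xi r) (SQS τ) = SQS τ.symm := by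
  apply qAct_eq_aux _ _ _ (xi_sub_aux τ h0)
  have h := xi_sub_aux τ.symm (by rw [Equiv.symm_apply_eq, h0])
  exact h

theorem aff_eq_aux {r : ℕ} (τ : Equiv.Perm (V r)) (a b : V r) (A B : V r ≃ₗ[ZMod 2] V r) :
    qAct (Equiv.sumCongr (affEquiv a A) (affEquiv b B)) (SQS τ) =
      SQS (A.symm.toEquiv.trans (τ.trans B.toEquiv)) := by
  apply qAct_eq_aux _ _ _ (aff_sub_aux τ a b A B)
  rw [Equiv.sumCongr_symm, aff_symm_aux, aff_symm_aux]
  refine (aff_sub_aux _ _ _ _ _).trans (le_of_eq ?_)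
  congr 1
  ext1 x
  simp

/-- `ξ` maps `SQS_τ` onto `SQS_{τ⁻¹}`; consequently
`(σ_{a,A}|σ_{b,B})·ξ` maps `SQS_τ` onto `SQS_{Bτ⁻¹A⁻¹}`. -/
theorem xi_maps_SQS_to_inv {r : ℕ} (τ : Equiv.Perm (V r)) (h0 : τ 0 = 0) :
    qAct (xi r) (SQS τ) = SQS τ.symm ∧
    ∀ (a b : V r) (A B : V r ≃ₗ[ZMod 2] V r),
      qAct ((xi r).trans (Equiv.sumCongr (affEquiv a A) (affEquiv b B))) (SQS τ)
        = SQS (A.symm.toEquiv.trans (τ.symm.trans B.toEquiv)) := by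
  refine ⟨xi_eq_aux τ h0, fun a b A B => ?_⟩
  rw [qAct_trans_aux, xi_eq_aux τ h0, aff_eq_aux]
end
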